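/- arXiv:1603.02906 — 2 statements merged into one kernel-verified Lean document; each statement's English description precedes it below -/
import Mathlib

section
/- Semi-orthogonality in dimension d: let κ ≥ 0 be constant and A = diag(α₁,…,α_d) a constant diagonal matrix. If multi-indices t, t' with |t| ≤ n, |t'| ≤ n satisfy |max(t,t')| > n (coordinatewise maximum, |·| the sum of entries), then for all i ∈ Ξ_t, i' ∈ Ξ_{t'}: ∫_{[0,1]^d} (∇φ_{t,i})ᵀ A ∇φ_{t',i'} + κ φ_{t,i} φ_{t',i'} dx = 0. -/
open MeasureTheory

noncomputable def hat (t i : ℕ) (x : ℝ) : ℝ :=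
  max 0 (1 - |x * 2 ^ (t + 1) - (i : ℝ)|)

def Idx (t : ℕ) : Finset ℕ := Finset.Icc 1 (2 ^ (t + 1) - 1)

def Xi (t : ℕ) : Finset ℕ := if t = 0 then {1} else (Idx t).filter (fun i => Odd i)

noncomputable def prew (t i : ℕ) (x : ℝ) : ℝ :=
  if t = 0 then hat 0 1 x
  else if i = 1 then 9/10 * hat t 1 x - 3/5 * hat t 2 x + 1/10 * hat t 3 x
  else if i = 2 ^ (t + 1) - 1 then
    9/10 * hat t i x - 3/5 * hat t (i-1) x + 1/10 * hat t (i-2) x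
  else hat t i x - 3/5 * (hat t (i+1) x + hat t (i-1) x)
    + 1/10 * (hat t (i+2) x + hat t (i-2) x)

/-- Tensor product pre-wavelet `φ_{t,i}(x) = ∏_s φ_{t_s,i_s}(x_s)`. -/
noncomputable def tprew (d : ℕ) (t i : Fin d → ℕ) (x : Fin d → ℝ) : ℝ :=
  ∏ s, prew (t s) (i s) (x s)

noncomputable def Bs (y : ℝ) : ℝ := max 0 (1 - |y|)

theorem hat_eq (t i : ℕ) (x : ℝ) : hat t i x = Bs (x * 2 ^ (t + 1) - i) := rfl

theorem Bs_zero {y : ℝ} (h : 1 ≤ |y|) : Bs y = 0 := by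
  unfold Bs; exact max_eq_left (by linarith)

theorem Bs_pos {y : ℝ} (h0 : 0 ≤ y) (h : y ≤ 1) : Bs y = 1 - y := by
  unfold Bs; rw [abs_of_nonneg h0]; exact max_eq_right (by linarith)

theorem Bs_neg {y : ℝ} (h0 : y ≤ 0) (h : -1 ≤ y) : Bs y = 1 + y := by
  unfold Bs; rw [abs_of_nonpos h0, max_eq_right (by linarith)]; ring

theorem Bs_even (y : ℝ) : Bs (-y) = Bs y := by simp [Bs]

theorem Bs_refine (y : ℝ) :
    Bs y = 1/2 * Bs (2 * y + 1) + Bs (2 * y) + 1/2 * Bs (2 * y - 1) := by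
  rcases le_total 0 y with h | h
  · rw [Bs_zero (y := 2 * y + 1) (by rw [le_abs]; left; linarith)]
    rcases le_total y (1/2) with h1 | h1
    · rw [Bs_pos h (by linarith), Bs_pos (y := 2 * y) (by linarith) (by linarith),
        Bs_neg (y := 2 * y - 1) (by linarith) (by linarith)]; ring
    · rw [Bs_zero (y := 2 * y) (by rw [le_abs]; left; linarith)]
      rcases le_total y 1 with h2 | h2
      · rw [Bs_pos h h2, Bs_pos (y := 2 * y - 1) (by linarith) (by linarith)]; ring
      · rw [Bs_zero (y := y) (by rw [le_abs]; left; linarith),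
          Bs_zero (y := 2 * y - 1) (by rw [le_abs]; left; linarith)]; ring
  · rw [Bs_zero (y := 2 * y - 1) (by rw [le_abs]; right; linarith)]
    rcases le_total (-1/2) y with h1 | h1
    · rw [Bs_neg h (by linarith), Bs_neg (y := 2 * y) (by linarith) (by linarith),
        Bs_pos (y := 2 * y + 1) (by linarith) (by linarith)]; ring
    · rw [Bs_zero (y := 2 * y) (by rw [le_abs]; right; linarith)]
      rcases le_total (-1) y with h2 | h2
      · rw [Bs_neg h h2, Bs_neg (y := 2 * y + 1) (by linarith) (by linarith)]; ring
      · rw [Bs_zero (y := y) (by rw [le_abs]; right; linarith),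
          Bs_zero (y := 2 * y + 1) (by rw [le_abs]; right; linarith)]; ring

theorem Bs_lip : LipschitzWith 1 Bs := by
  refine LipschitzWith.of_dist_le_mul fun x y => ?_
  simp only [Real.dist_eq, Bs, NNReal.coe_one, one_mul]
  calc |max 0 (1 - |x|) - max 0 (1 - |y|)| ≤ |(1 - |x|) - (1 - |y|)| := by
        have := abs_max_sub_max_le_abs (1 - |x|) (1 - |y|) 0
        rwa [max_comm 0, max_comm 0]
    _ = |(|y| - |x|)| := by congr 1; ring
    _ ≤ |y - x| := abs_abs_sub_abs_le _ _
    _ = |x - y| := abs_sub_comm _ _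

theorem Bs_cont : Continuous Bs := Bs_lip.continuous

theorem hat_cont (t i : ℕ) : Continuous (hat t i) := by
  have : hat t i = fun x => Bs (x * 2 ^ (t + 1) - i) := rfl
  rw [this]
  exact Bs_cont.comp (by fun_prop)

theorem hat_lip (t i : ℕ) : ∃ K, LipschitzWith K (hat t i) := by
  refine ⟨2 ^ (t+1), LipschitzWith.of_dist_le_mul fun x y => ?_⟩
  rw [hat_eq, hat_eq]
  refine (Bs_lip.dist_le_mul _ _).trans ?_
  simp only [Real.dist_eq, NNReal.coe_one, one_mul]
  have : x * 2 ^ (t + 1) - (i:ℝ) - (y * 2 ^ (t + 1) - i) = 2 ^ (t+1) * (x - y) := by ring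
  rw [this, abs_mul]
  simp

theorem hat_supp {t i : ℕ} (hi : i ∈ Idx t) {x : ℝ} (hx : x ∉ Set.Icc (0:ℝ) 1) :
    hat t i x = 0 := by
  rw [hat_eq]
  apply Bs_zero
  simp only [Idx, Finset.mem_Icc] at hi
  have h1 : (1:ℝ) ≤ i := by exact_mod_cast hi.1
  have h2 : (i:ℝ) + 1 ≤ 2 ^ (t+1) := by
    have := Nat.one_le_two_pow (n := t+1)
    have h : i + 1 ≤ 2 ^ (t+1) := by omega
    exact_mod_cast h
  simp only [Set.mem_Icc, not_and_or, not_le] at hx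
  have hp : (0:ℝ) < 2 ^ (t+1) := by positivity
  rw [le_abs]
  rcases hx with hx | hx
  · right; nlinarith
  · left; nlinarith

theorem hat_refine (t i : ℕ) (hi : 1 ≤ i) (x : ℝ) :
    hat t i x = 1/2 * hat (t+1) (2*i-1) x + hat (t+1) (2*i) x + 1/2 * hat (t+1) (2*i+1) x := by
  simp only [hat_eq]
  rw [Bs_refine]
  rw [Nat.cast_sub (by omega)]
  push_cast
  congr 3
  · congr 1; ring
  · congr 1; ring
  · ring_nf

/-- Gram entries. -/
noncomputable def gc (k : ℤ) : ℝ := if k = 0 then 2/3 else if k = 1 ∨ k = -1 then 1/6 else 0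

theorem Bs_int_one : ∫ y, Bs y * Bs (y - 1) = 1/6 := by
  rw [← setIntegral_eq_integral_of_forall_compl_eq_zero (s := Set.Ioc (0:ℝ) 1)]
  · rw [← intervalIntegral.integral_of_le zero_le_one]
    rw [intervalIntegral.integral_congr (g := fun y : ℝ => y - y^2)]
    · rw [intervalIntegral.integral_sub (by simp) (by simp)]
      simp; norm_num
    · intro y hy
      rw [Set.uIcc_of_le zero_le_one] at hy
      simp only
      rw [Bs_pos hy.1 hy.2, Bs_neg (by linarith [hy.2]) (by linarith [hy.1])]
      ring
  · intro x hx
    simp only [Set.mem_Ioc, not_and_or, not_lt, not_le] at hx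
    rcases hx with hx | hx
    · rw [Bs_zero (y := x - 1), mul_zero]
      rw [le_abs]; right; linarith
    · rw [Bs_zero (y := x), zero_mul]
      rw [le_abs]; left; linarith

theorem Bs_int_zero : ∫ y, Bs y * Bs y = 2/3 := by
  have hc : Continuous fun y => Bs y * Bs y := Bs_cont.mul Bs_cont
  rw [← setIntegral_eq_integral_of_forall_compl_eq_zero (s := Set.Ioc (-1:ℝ) 1)]
  · rw [← intervalIntegral.integral_of_le (by norm_num),
      ← intervalIntegral.integral_add_adjacent_intervals (b := 0)
        (hc.intervalIntegrable _ _) (hc.intervalIntegrable _ _)]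
    have e1 : ∫ y in (0:ℝ)..1, Bs y * Bs y = 1/3 := by
      rw [intervalIntegral.integral_congr (g := fun y : ℝ => (1 - y)^2)]
      · rw [intervalIntegral.integral_comp_sub_left (fun y : ℝ => y^2)]
        simp; try norm_num
      · intro y hy
        rw [Set.uIcc_of_le zero_le_one] at hy
        simp only
        rw [Bs_pos hy.1 hy.2]
        ring
    have e2 : ∫ y in (-1:ℝ)..0, Bs y * Bs y = 1/3 := by
      rw [← e1]
      have := intervalIntegral.integral_comp_neg (fun y => Bs y * Bs y) (a := 0) (b := 1)
      simp only [Bs_even, neg_zero] at this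
      exact this.symm
    rw [e1, e2]; norm_num
  · intro x hx
    rw [Bs_zero (y := x), zero_mul]
    simp only [Set.mem_Ioc, not_and_or, not_lt, not_le] at hx
    rw [le_abs]; 
    rcases hx with hx | hx
    · right; linarith
    · left; linarith

theorem Bs_int (k : ℤ) : ∫ y, Bs y * Bs (y - k) = gc k := by
  unfold gc
  split_ifs with h0 h1
  · subst h0; simpa using Bs_int_zero
  · rcases h1 with rfl | rfl
    · simpa using Bs_int_one
    · rw [← Bs_int_one, ← integral_neg_eq_self]
      congr 1; ext y
      rw [Bs_even, ← Bs_even (-y - _)]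
      congr 2; push_cast; ring
  · have : ∀ y : ℝ, Bs y * Bs (y - k) = 0 := by
      intro y
      by_cases hy : 1 ≤ |y|
      · rw [Bs_zero hy, zero_mul]
      · rw [Bs_zero (y := y - k), mul_zero]
        have h2 : (2:ℤ) ≤ |k| := by
          rw [le_abs]; omega
        have h3 : (2:ℝ) ≤ |(k:ℝ)| := by exact_mod_cast h2
        have := abs_sub_abs_le_abs_sub (k:ℝ) y
        rw [abs_sub_comm]; linarith
    simp [this]

theorem gram (t i j : ℕ) (hi : i ∈ Idx t) :
    ∫ x in Set.Icc (0:ℝ) 1, hat t i x * hat t j x = (2 ^ (t+1))⁻¹ * gc ((j:ℤ) - i) := by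
  rw [setIntegral_eq_integral_of_forall_compl_eq_zero
    (fun x hx => by rw [hat_supp hi hx, zero_mul])]
  simp only [hat_eq]
  rw [← Bs_int]
  have h1 := Measure.integral_comp_mul_right
    (fun z : ℝ => Bs (z - i) * Bs (z - j)) ((2:ℝ) ^ (t+1))
  have h2 := integral_sub_right_eq_self (μ := volume)
    (fun z : ℝ => Bs z * Bs (z - ((j:ℤ) - (i:ℤ) : ℤ))) (i:ℝ)
  rw [h1, ← h2, abs_of_pos (by positivity), smul_eq_mul]
  congr 2; ext z; congr 2; push_cast; ring

theorem intOn {u v : ℝ → ℝ} (hu : Continuous u) (hv : Continuous v) :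
    Integrable (fun x => u x * v x) (volume.restrict (Set.Icc (0:ℝ) 1)) :=
  (hu.mul hv).continuousOn.integrableOn_Icc

theorem int5 {u f1 f2 f3 f4 f5 : ℝ → ℝ} (hu : Continuous u) (h1 : Continuous f1)
    (h2 : Continuous f2) (h3 : Continuous f3) (h4 : Continuous f4) (h5 : Continuous f5)
    (a b c d e : ℝ) :
    ∫ x in Set.Icc (0:ℝ) 1, (a * f1 x + b * f2 x + c * f3 x + d * f4 x + e * f5 x) * u x =
      a * (∫ x in Set.Icc (0:ℝ) 1, f1 x * u x) + b * (∫ x in Set.Icc (0:ℝ) 1, f2 x * u x)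
      + c * (∫ x in Set.Icc (0:ℝ) 1, f3 x * u x) + d * (∫ x in Set.Icc (0:ℝ) 1, f4 x * u x)
      + e * (∫ x in Set.Icc (0:ℝ) 1, f5 x * u x) := by
  have i1 := (intOn h1 hu).const_mul a
  have i2 := (intOn h2 hu).const_mul b
  have i3 := (intOn h3 hu).const_mul c
  have i4 := (intOn h4 hu).const_mul d
  have i5 := (intOn h5 hu).const_mul e
  simp only [← integral_const_mul]
  have j2 := integral_add i1 i2
  have j3 := integral_add (i1.add i2) i3
  have j4 := integral_add ((i1.add i2).add i3) i4
  have j5 := integral_add (((i1.add i2).add i3).add i4) i5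
  simp only [Pi.add_apply] at j2 j3 j4 j5
  rw [← j2, ← j3, ← j4, ← j5]
  congr 1; ext x; ring

noncomputable def gd (k : ℤ) : ℝ :=
  if k = 0 then 5/6 else if k = 1 ∨ k = -1 then 1/2 else if k = 2 ∨ k = -2 then 1/12 else 0

theorem gd_eq (k : ℤ) : gd k = 1/2 * gc (k - 1) + gc k + 1/2 * gc (k + 1) := by
  by_cases h : k = 0 ∨ k = 1 ∨ k = -1 ∨ k = 2 ∨ k = -2
  · rcases h with rfl | rfl | rfl | rfl | rfl <;> norm_num [gc, gd]
  · unfold gd gc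
    rw [if_neg (by omega), if_neg (by omega), if_neg (by omega), if_neg (by omega),
      if_neg (by omega), if_neg (by omega), if_neg (by omega), if_neg (by omega), if_neg (by omega)]
    norm_num

theorem gd_zero {k : ℤ} (h : 3 ≤ k ∨ k ≤ -3) : gd k = 0 := by
  unfold gd
  rw [if_neg (by omega), if_neg (by omega), if_neg (by omega)]

theorem mem_Idx {t i : ℕ} : i ∈ Idx t ↔ 1 ≤ i ∧ i + 1 ≤ 2 ^ (t+1) := by
  have := Nat.one_le_two_pow (n := t+1)
  simp only [Idx, Finset.mem_Icc]; omega

theorem gram2 (m j k : ℕ) (hj : j ∈ Idx m) :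
    ∫ x in Set.Icc (0:ℝ) 1, hat (m+1) k x * hat m j x
      = (2 ^ (m+2))⁻¹ * gd ((k:ℤ) - 2 * j) := by
  obtain ⟨h1, h2⟩ := mem_Idx.1 hj
  have hp : 2 ^ (m+1+1) = 2 * 2 ^ (m+1) := by ring
  have := int5 (hat_cont (m+1) k) (hat_cont (m+1) (2*j-1)) (hat_cont (m+1) (2*j))
    (hat_cont (m+1) (2*j+1)) (hat_cont 0 0) (hat_cont 0 0) (1/2) 1 (1/2) 0 0
  rw [gram _ _ _ (mem_Idx.2 (by omega)), gram _ _ _ (mem_Idx.2 (by omega)),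
    gram _ _ _ (mem_Idx.2 (by omega))] at this
  rw [gd_eq]
  have e1 : (k:ℤ) - ((2*j-1 : ℕ):ℤ) = k - 2*j + 1 := by omega
  have e2 : (k:ℤ) - ((2*j : ℕ):ℤ) = k - 2*j := by omega
  have e3 : (k:ℤ) - ((2*j+1 : ℕ):ℤ) = k - 2*j - 1 := by omega
  rw [e1, e2, e3] at this
  have e4 : ∀ x, hat (m+1) k x * hat m j x =
    (1 / 2 * hat (m + 1) (2 * j - 1) x + 1 * hat (m + 1) (2 * j) x
      + 1 / 2 * hat (m + 1) (2 * j + 1) x + 0 * hat 0 0 x + 0 * hat 0 0 x) * hat (m + 1) k x := by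
    intro x; rw [hat_refine m j h1]; ring
  simp only [e4]
  rw [this]; ring

theorem prew_cont (t i : ℕ) : Continuous (prew t i) := by
  have := hat_cont
  unfold prew
  split_ifs <;> fun_prop

theorem orth_base (m i j : ℕ) (hi : i ∈ Xi (m+1)) (hj : j ∈ Idx m) :
    ∫ x in Set.Icc (0:ℝ) 1, prew (m+1) i x * hat m j x = 0 := by
  simp only [Xi, Nat.succ_ne_zero, if_false, Finset.mem_filter, mem_Idx] at hi
  obtain ⟨⟨hi1, hi2⟩, q, hq⟩ := hi
  obtain ⟨hj1, hj2⟩ := mem_Idx.1 hj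
  have hp : 2 ^ (m+1+1) = 2 * 2 ^ (m+1) := by ring
  have hc := hat_cont
  unfold prew
  simp only [Nat.succ_ne_zero, if_false]
  split_ifs with h1 h2
  · have := int5 (hc m j) (hc (m+1) 1) (hc (m+1) 2) (hc (m+1) 3) (hc 0 0) (hc 0 0)
      (9/10) (-3/5) (1/10) 0 0
    rw [gram2 _ _ _ hj, gram2 _ _ _ hj, gram2 _ _ _ hj] at this
    trans
    · refine Eq.trans ?_ this
      congr 1; ext x; ring
    · by_cases h : j = 1 ∨ j = 2
      · rcases h with rfl | rfl <;> norm_num [gd] <;> ring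
      · rw [gd_zero (by omega), gd_zero (by omega), gd_zero (by omega)]; ring
  · have := int5 (hc m j) (hc (m+1) i) (hc (m+1) (i-1)) (hc (m+1) (i-2)) (hc 0 0) (hc 0 0)
      (9/10) (-3/5) (1/10) 0 0
    rw [gram2 _ _ _ hj, gram2 _ _ _ hj, gram2 _ _ _ hj] at this
    trans
    · refine Eq.trans ?_ this
      congr 1; ext x; ring
    · obtain ⟨p, hp⟩ : ∃ p : ℤ, p = (i:ℤ) - 2 * j := ⟨_, rfl⟩
      have e1 : ((i-1 : ℕ):ℤ) - 2 * j = p - 1 := by omega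
      have e2 : ((i-2 : ℕ):ℤ) - 2 * j = p - 2 := by omega
      rw [e1, e2, ← hp]
      by_cases h : p = 1 ∨ p = 3
      · rcases h with h | h <;> rw [h] <;> norm_num [gd] <;> ring
      · rw [gd_zero (by omega), gd_zero (by omega), gd_zero (by omega)]; ring
  · have := int5 (hc m j) (hc (m+1) i) (hc (m+1) (i+1)) (hc (m+1) (i-1)) (hc (m+1) (i+2))
      (hc (m+1) (i-2)) 1 (-3/5) (-3/5) (1/10) (1/10)
    rw [gram2 _ _ _ hj, gram2 _ _ _ hj, gram2 _ _ _ hj, gram2 _ _ _ hj, gram2 _ _ _ hj] at this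
    trans
    · refine Eq.trans ?_ this
      congr 1; ext x; ring
    · obtain ⟨p, hp⟩ : ∃ p : ℤ, p = (i:ℤ) - 2 * j := ⟨_, rfl⟩
      have e1 : ((i-1 : ℕ):ℤ) - 2 * j = p - 1 := by omega
      have e2 : ((i-2 : ℕ):ℤ) - 2 * j = p - 2 := by omega
      have e3 : ((i+1 : ℕ):ℤ) - 2 * j = p + 1 := by omega
      have e4 : ((i+2 : ℕ):ℤ) - 2 * j = p + 2 := by omega
      rw [e1, e2, e3, e4, ← hp]
      by_cases h : p = 1 ∨ p = 3 ∨ p = -1 ∨ p = -3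
      · rcases h with h | h | h | h <;> rw [h] <;> norm_num [gd] <;> ring
      · rw [gd_zero (by omega), gd_zero (by omega), gd_zero (by omega), gd_zero (by omega),
          gd_zero (by omega)]; ring

theorem orth_hat (i t k j : ℕ) (hi : i ∈ Xi (t+k+1)) (hj : j ∈ Idx t) :
    ∫ x in Set.Icc (0:ℝ) 1, hat t j x * prew (t+k+1) i x = 0 := by
  induction k generalizing t j with
  | zero =>
    refine Eq.trans ?_ (orth_base t i j hi hj)
    congr 1; ext x; exact mul_comm _ _
  | succ k ih =>
    have e : t + (k + 1) + 1 = (t + 1) + k + 1 := by ring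
    rw [e] at hi ⊢
    obtain ⟨h1, h2⟩ := mem_Idx.1 hj
    have hp : 2 ^ (t+1+1) = 2 * 2 ^ (t+1) := by ring
    have := int5 (prew_cont (t+1+k+1) i) (hat_cont (t+1) (2*j-1)) (hat_cont (t+1) (2*j))
      (hat_cont (t+1) (2*j+1)) (hat_cont 0 0) (hat_cont 0 0) (1/2) 1 (1/2) 0 0
    rw [ih _ _ hi (mem_Idx.2 (by omega)), ih _ _ hi (mem_Idx.2 (by omega)),
      ih _ _ hi (mem_Idx.2 (by omega))] at this
    refine Eq.trans ?_ (this.trans (by ring))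
    congr 1; ext x; rw [hat_refine t j h1]; ring

theorem prew_ind (P : (ℝ → ℝ) → Prop) (t i : ℕ) (hi : i ∈ Xi t)
    (hh : ∀ j ∈ Idx t, P (hat t j)) 
    (hl : ∀ f1 f2 f3 f4 f5, P f1 → P f2 → P f3 → P f4 → P f5 → ∀ a b c d e : ℝ,
      P (fun x => a * f1 x + b * f2 x + c * f3 x + d * f4 x + e * f5 x)) : P (prew t i) := by
  unfold prew
  by_cases h0 : t = 0
  · subst h0
    simpa using hh 1 (by simp [mem_Idx])
  · simp only [Xi, h0, if_false, Finset.mem_filter, mem_Idx] at hi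
    obtain ⟨⟨hi1, hi2⟩, q, hq⟩ := hi
    obtain ⟨m, rfl⟩ := Nat.exists_eq_succ_of_ne_zero h0
    have hp : 2 ^ (m.succ+1) = 4 * 2 ^ m := by rw [Nat.succ_eq_add_one]; ring
    have := Nat.one_le_two_pow (n := m)
    simp only [h0, if_false]
    have H : ∀ j, 1 ≤ j → j + 1 ≤ 2 ^ (m.succ+1) → P (hat m.succ j) := fun j a b =>
      hh j (mem_Idx.2 ⟨a, b⟩)
    have one := H 1 (by omega) (by omega)
    split_ifs with h1 h2
    · convert hl _ _ _ _ _ (H 1 (by omega) (by omega)) (H 2 (by omega) (by omega))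
        (H 3 (by omega) (by omega)) one one (9/10) (-3/5) (1/10) 0 0 using 2
      ring
    · convert hl _ _ _ _ _ (H i (by omega) (by omega)) (H (i-1) (by omega) (by omega))
        (H (i-2) (by omega) (by omega)) one one (9/10) (-3/5) (1/10) 0 0 using 2
      ring
    · convert hl _ _ _ _ _ (H i (by omega) (by omega)) (H (i+1) (by omega) (by omega))
        (H (i-1) (by omega) (by omega)) (H (i+2) (by omega) (by omega))
        (H (i-2) (by omega) (by omega)) 1 (-3/5) (-3/5) (1/10) (1/10) using 2
      ring

theorem prew_lip (t i : ℕ) (hi : i ∈ Xi t) : ∃ K, LipschitzWith K (prew t i) := by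
  refine prew_ind (fun f => ∃ K, LipschitzWith K f) t i hi (fun j _ => hat_lip t j) ?_
  rintro f1 f2 f3 f4 f5 ⟨k1, h1⟩ ⟨k2, h2⟩ ⟨k3, h3⟩ ⟨k4, h4⟩ ⟨k5, h5⟩ a b c d e
  have key : ∀ (a : ℝ) {f : ℝ → ℝ} {k}, LipschitzWith k f →
      LipschitzWith (‖a‖₊ * k) (fun x => a * f x) := fun a f k h =>
    (lipschitzWith_smul a).comp h
  exact ⟨_, ((((key a h1).add (key b h2)).add (key c h3)).add (key d h4)).add (key e h5)⟩

theorem orth_lt (t t' i i' : ℕ) (hi : i ∈ Xi t) (hi' : i' ∈ Xi t') (h : t < t') :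
    ∫ x in Set.Icc (0:ℝ) 1, prew t i x * prew t' i' x = 0 := by
  obtain ⟨k, rfl⟩ : ∃ k, t' = t + k + 1 := ⟨t' - t - 1, by omega⟩
  refine (prew_ind (fun f => Continuous f ∧ ∫ x in Set.Icc (0:ℝ) 1, f x * prew (t+k+1) i' x = 0)
    t i hi (fun j hj => ⟨hat_cont t j, orth_hat i' t k j hi' hj⟩) ?_).2
  rintro f1 f2 f3 f4 f5 ⟨c1, h1⟩ ⟨c2, h2⟩ ⟨c3, h3⟩ ⟨c4, h4⟩ ⟨c5, h5⟩ a b c d e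
  refine ⟨by fun_prop, ?_⟩
  rw [int5 (prew_cont _ _) c1 c2 c3 c4 c5, h1, h2, h3, h4, h5]; ring

theorem orth (t t' i i' : ℕ) (hi : i ∈ Xi t) (hi' : i' ∈ Xi t') (h : t ≠ t') :
    ∫ x in Set.Icc (0:ℝ) 1, prew t i x * prew t' i' x = 0 := by
  rcases lt_or_gt_of_ne h with h | h
  · exact orth_lt t t' i i' hi hi' h
  · refine Eq.trans ?_ (orth_lt t' t i' i hi' hi h)
    congr 1; ext x; ring

theorem tprew_fderiv (d : ℕ) (t i : Fin d → ℕ) (x : Fin d → ℝ)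
    (hx : ∀ s, DifferentiableAt ℝ (prew (t s) (i s)) (x s)) (s : Fin d) :
    fderiv ℝ (tprew d t i) x (Pi.single s 1) =
      ∏ r, (if r = s then deriv (prew (t r) (i r)) (x r) else prew (t r) (i r) (x r)) := by
  have h0 : ∀ r, HasFDerivAt (fun y : Fin d → ℝ => prew (t r) (i r) (y r))
      (deriv (prew (t r) (i r)) (x r) •
        ContinuousLinearMap.proj (R := ℝ) (φ := fun _ : Fin d => ℝ) r) x := fun r =>
    HasDerivAt.comp_hasFDerivAt (f := fun y : Fin d → ℝ => y r) x (hx r).hasDerivAt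
      (ContinuousLinearMap.proj (R := ℝ) (φ := fun _ : Fin d => ℝ) r).hasFDerivAt
  have h : HasFDerivAt (tprew d t i) _ x :=
    HasFDerivAt.finsetProd (u := Finset.univ) (fun r _ => h0 r)
  rw [h.fderiv]
  simp only [ContinuousLinearMap.sum_apply, ContinuousLinearMap.smul_apply,
    ContinuousLinearMap.comp_apply, ContinuousLinearMap.proj_apply]
  rw [Finset.sum_eq_single s]
  · rw [← Finset.mul_prod_erase Finset.univ _ (Finset.mem_univ s)]
    have : ∏ r ∈ Finset.univ.erase s,
        (if r = s then deriv (prew (t r) (i r)) (x r) else prew (t r) (i r) (x r))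
        = ∏ r ∈ Finset.univ.erase s, prew (t r) (i r) (x r) :=
      Finset.prod_congr rfl fun r hr => if_neg (Finset.ne_of_mem_erase hr)
    rw [this]
    simp [mul_comm]
  · intro b _ hb
    simp [Pi.single_apply, hb]
  · simp

theorem deriv_int (t i t' i' : ℕ) (hi : i ∈ Xi t) (hi' : i' ∈ Xi t') :
    Integrable (fun x => deriv (prew t i) x * deriv (prew t' i') x)
      (volume.restrict (Set.Icc (0:ℝ) 1)) := by
  obtain ⟨K, hK⟩ := prew_lip t i hi
  obtain ⟨K', hK'⟩ := prew_lip t' i' hi'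
  refine Integrable.of_bound
    ((measurable_deriv _).mul (measurable_deriv _)).aestronglyMeasurable (K * K')
    (Filter.Eventually.of_forall fun x => ?_)
  rw [norm_mul]
  exact mul_le_mul (norm_deriv_le_of_lipschitz hK) (norm_deriv_le_of_lipschitz hK')
    (norm_nonneg _) K.2

theorem exists_levels {d n : ℕ} {t t' : Fin d → ℕ} (htn : (∑ s, t s) ≤ n)
    (hmax : n < ∑ s, max (t s) (t' s)) : ∃ s, t s < t' s := by
  by_contra hcon
  push Not at hcon
  have : ∑ s, max (t s) (t' s) = ∑ s, t s :=
    Finset.sum_congr rfl fun s _ => max_eq_left (hcon s)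
  omega

/-- Semi-orthogonality: for constant `κ ≥ 0` and constant diagonal
`A = diag(α₁,…,α_d)`, if `|t| ≤ n`, `|t'| ≤ n` and `|max(t,t')| > n`, then
`∫_{[0,1]^d} (∇φ_{t,i})ᵀ A ∇φ_{t',i'} + κ φ_{t,i} φ_{t',i'} dx = 0`. -/
theorem semi_orthogonality (d n : ℕ) (κ : ℝ) (hκ : 0 ≤ κ) (α : Fin d → ℝ)
    (t t' i i' : Fin d → ℕ)
    (hi : ∀ s, i s ∈ Xi (t s)) (hi' : ∀ s, i' s ∈ Xi (t' s))
    (htn : (∑ s, t s) ≤ n) (ht'n : (∑ s, t' s) ≤ n)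
    (hmax : n < ∑ s, max (t s) (t' s)) :
    ∫ x in Set.univ.pi (fun _ : Fin d => Set.Icc (0:ℝ) 1),
      ((∑ s, α s * fderiv ℝ (tprew d t i) x (Pi.single s 1)
          * fderiv ℝ (tprew d t' i') x (Pi.single s 1))
        + κ * tprew d t i x * tprew d t' i' x) = 0 := by

  obtain ⟨s1, h1⟩ := exists_levels htn hmax
  obtain ⟨s2, h2⟩ := exists_levels (t := t') (t' := t) ht'n (by simpa only [max_comm] using hmax)
  have hne : s1 ≠ s2 := by rintro rfl; omega
  -- the one-dimensional factors
  let G : Fin d → ℝ → ℝ := fun r x => prew (t r) (i r) x * prew (t' r) (i' r) x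
  let F : Fin d → Fin d → ℝ → ℝ := fun s r x =>
    if r = s then deriv (prew (t r) (i r)) x * deriv (prew (t' r) (i' r)) x else G r x
  have hvol : (volume : Measure (Fin d → ℝ)).restrict
      (Set.univ.pi (fun _ : Fin d => Set.Icc (0:ℝ) 1))
      = Measure.pi (fun _ : Fin d => (volume : Measure ℝ).restrict (Set.Icc (0:ℝ) 1)) := by
    rw [volume_pi, Measure.restrict_pi_pi]
  have hG : ∀ r, Integrable (G r) (volume.restrict (Set.Icc (0:ℝ) 1)) := fun r =>
    intOn (prew_cont _ _) (prew_cont _ _)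
  have hF : ∀ s r, Integrable (F s r) (volume.restrict (Set.Icc (0:ℝ) 1)) := by
    intro s r
    by_cases h : r = s
    · simpa only [F, h, if_true] using deriv_int _ _ _ _ (hi s) (hi' s)
    · simpa only [F, h, if_false] using hG r
  have hG0 : ∀ r, t r ≠ t' r → ∫ x in Set.Icc (0:ℝ) 1, G r x = 0 := fun r hr =>
    orth _ _ _ _ (hi r) (hi' r) hr
  have hae : ∀ᵐ x ∂((volume : Measure (Fin d → ℝ)).restrict
      (Set.univ.pi (fun _ : Fin d => Set.Icc (0:ℝ) 1))),
      ((∑ s, α s * fderiv ℝ (tprew d t i) x (Pi.single s 1)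
          * fderiv ℝ (tprew d t' i') x (Pi.single s 1))
        + κ * tprew d t i x * tprew d t' i' x)
      = (∑ s, α s * ∏ r, F s r (x r)) + κ * ∏ r, G r (x r) := by
    refine ae_restrict_of_ae ?_
    have key : ∀ (t i : Fin d → ℕ), (∀ s, i s ∈ Xi (t s)) →
        ∀ᵐ x : Fin d → ℝ, ∀ s, DifferentiableAt ℝ (prew (t s) (i s)) (x s) := by
      intro t i hi
      rw [ae_all_iff]
      intro s
      obtain ⟨K, hK⟩ := prew_lip _ _ (hi s)
      exact (Measure.quasiMeasurePreserving_eval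
        (fun _ : Fin d => (volume : Measure ℝ)) s).ae hK.ae_differentiableAt_real
    filter_upwards [key t i hi, key t' i' hi'] with x hx hx'
    congr 1
    · refine Finset.sum_congr rfl fun s _ => ?_
      rw [tprew_fderiv d t i x hx, tprew_fderiv d t' i' x hx', mul_assoc,
        ← Finset.prod_mul_distrib]
      congr 1
      refine Finset.prod_congr rfl fun r _ => ?_
      by_cases h : r = s <;> simp [F, G, h]
    · rw [mul_assoc, tprew, tprew, ← Finset.prod_mul_distrib]
  rw [integral_congr_ae hae, hvol, integral_add, integral_finsetSum]
  · rw [integral_const_mul, integral_fintype_prod_eq_prod,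
      Finset.prod_eq_zero (Finset.mem_univ s1) (hG0 s1 (by omega)), mul_zero, add_zero]
    refine Finset.sum_eq_zero fun s _ => ?_
    rw [integral_const_mul, integral_fintype_prod_eq_prod]
    obtain ⟨r, hr, hlev⟩ : ∃ r, r ≠ s ∧ t r ≠ t' r := by
      by_cases h : s1 = s
      · exact ⟨s2, fun h' => hne (h.trans h'.symm), by omega⟩
      · exact ⟨s1, h, by omega⟩
    rw [Finset.prod_eq_zero (Finset.mem_univ r), mul_zero]
    simpa only [F, hr, if_false] using hG0 r hlev
  · exact fun s _ => (Integrable.fintype_prod (hF s)).const_mul _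
  · exact integrable_finsetSum _ fun s _ => (Integrable.fintype_prod (hF s)).const_mul _
  · exact (Integrable.fintype_prod hG).const_mul _
end

section
/- The semi-orthogonal bilinear form a_n^{semi-ortho} agrees with the exact bilinear form a on V^{prew}_{𝒟_n} whenever the coefficients are constant and A is diagonal; i.e. for constant κ ≥ 0 and constant diagonal positive definite A, the stiffness matrices of Discretization a_n^{semi-ortho} and of the standard Ritz–Galerkin discretization on V^{prew}_{𝒟_n} are equal. -/
open MeasureTheory

/-- The bilinear form `a(u,v) = ∫_Ω (∇u)ᵀ diag(α) ∇v + κ u v dx` on `Ω = [0,1]^d`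
with constant diagonal coefficient matrix and constant `κ`. -/
noncomputable def bform (d : ℕ) (α : Fin d → ℝ) (κ : ℝ) (u v : (Fin d → ℝ) → ℝ) : ℝ :=
  ∫ x in Set.univ.pi (fun _ : Fin d => Set.Icc (0:ℝ) 1),
    ((∑ s, α s * fderiv ℝ u x (Pi.single s 1) * fderiv ℝ v x (Pi.single s 1))
      + κ * u x * v x)

theorem lip_facts {f : ℝ → ℝ} (hf : ∃ K : ℝ, ∀ x y, |f x - f y| ≤ K * |x - y|) :
    ∃ C, LipschitzWith C f := by
  obtain ⟨K, hK⟩ := hf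
  exact ⟨K.toNNReal, LipschitzWith.of_dist_le' fun x y => by
    simpa [Real.dist_eq] using hK x y⟩

/-- the factors of the `s`-th gradient term -/
noncomputable def gfac (d : ℕ) (g g' : Fin d → ℝ → ℝ) (s : Fin d) (r : Fin d) (y : ℝ) : ℝ :=
  if r = s then deriv (g r) y * deriv (g' r) y else g r y * g' r y

theorem fderiv_tensor (d : ℕ) (g : Fin d → ℝ → ℝ) (x : Fin d → ℝ)
    (hx : ∀ r, DifferentiableAt ℝ (g r) (x r)) (s : Fin d) :
    fderiv ℝ (fun x : Fin d → ℝ => ∏ r, g r (x r)) x (Pi.single s 1)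
      = ∏ r, (if r = s then deriv (g r) (x r) else g r (x r)) := by
  have h : ∀ r ∈ (Finset.univ : Finset (Fin d)), HasFDerivAt (fun x : Fin d → ℝ => g r (x r))
      (deriv (g r) (x r) • (ContinuousLinearMap.proj r : (Fin d → ℝ) →L[ℝ] ℝ)) x := by
    intro r _
    exact (hx r).hasDerivAt.comp_hasFDerivAt x
      (ContinuousLinearMap.proj r : (Fin d → ℝ) →L[ℝ] ℝ).hasFDerivAt
  rw [(HasFDerivAt.finsetProd h).fderiv]
  simp only [sum_apply, smul_apply,
    ContinuousLinearMap.proj_apply, smul_eq_mul]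
  rw [Finset.sum_eq_single s]
  · rw [← Finset.prod_erase_mul Finset.univ _ (Finset.mem_univ s)]
    simp only [Pi.single_eq_same, mul_one, if_true]
    congr 1
    apply Finset.prod_congr rfl
    intro r hr
    rw [if_neg (Finset.ne_of_mem_erase hr)]
  · intro b _ hb
    simp [Pi.single_eq_of_ne hb]
  · simp

theorem bform_zero (d : ℕ) (α : Fin d → ℝ) (κ : ℝ) (g g' : Fin d → ℝ → ℝ)
    (hg : ∀ r, ∃ C, LipschitzWith C (g r)) (hg' : ∀ r, ∃ C, LipschitzWith C (g' r))
    (s₁ s₂ : Fin d) (hs : s₁ ≠ s₂)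
    (h₁ : ∫ y in Set.Icc (0:ℝ) 1, g s₁ y * g' s₁ y = 0)
    (h₂ : ∫ y in Set.Icc (0:ℝ) 1, g s₂ y * g' s₂ y = 0) :
    bform d α κ (fun x => ∏ r, g r (x r)) (fun x => ∏ r, g' r (x r)) = 0 := by
  unfold bform
  rw [volume_pi, Measure.restrict_pi_pi]
  set μ : Measure ℝ := volume.restrict (Set.Icc (0:ℝ) 1) with hμ
  have hae : ∀ g : Fin d → ℝ → ℝ, (∀ r, ∃ C, LipschitzWith C (g r)) →
      ∀ᵐ x ∂(Measure.pi fun _ : Fin d => μ), ∀ r, DifferentiableAt ℝ (g r) (x r) := by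
    intro g hg
    rw [ae_all_iff]
    intro r
    obtain ⟨C, hC⟩ := hg r
    have : ∀ᵐ y ∂μ, DifferentiableAt ℝ (g r) y := ae_restrict_of_ae hC.ae_differentiableAt_real
    exact (Measure.tendsto_eval_ae_ae (μ := fun _ : Fin d => μ) (i := r)).eventually this
  have hcong : ∀ᵐ x ∂(Measure.pi fun _ : Fin d => μ),
      ((∑ s, α s * fderiv ℝ (fun x : Fin d → ℝ => ∏ r, g r (x r)) x (Pi.single s 1)
        * fderiv ℝ (fun x : Fin d → ℝ => ∏ r, g' r (x r)) x (Pi.single s 1))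
      + κ * (∏ r, g r (x r)) * ∏ r, g' r (x r))
      = (∑ s, α s * ∏ r, gfac d g g' s r (x r)) + κ * ∏ r, (g r (x r) * g' r (x r)) := by
    filter_upwards [hae g hg, hae g' hg'] with x hx hx'
    congr 1
    · apply Finset.sum_congr rfl
      intro s _
      rw [fderiv_tensor d g x hx, fderiv_tensor d g' x hx', mul_assoc, ← Finset.prod_mul_distrib]
      congr 1
      apply Finset.prod_congr rfl
      intro r _
      unfold gfac
      split_ifs <;> rfl
    · rw [mul_assoc, ← Finset.prod_mul_distrib]
  rw [integral_congr_ae hcong]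
  have hmass : ∀ r, Integrable (fun y => g r y * g' r y) μ := by
    intro r
    obtain ⟨C, hC⟩ := hg r
    obtain ⟨C', hC'⟩ := hg' r
    exact (hC.continuous.mul hC'.continuous).continuousOn.integrableOn_compact isCompact_Icc
  have hstiff : ∀ r, Integrable (fun y => deriv (g r) y * deriv (g' r) y) μ := by
    intro r
    obtain ⟨C, hC⟩ := hg r
    obtain ⟨C', hC'⟩ := hg' r
    refine Integrable.of_bound (C := C * C')
      ((measurable_deriv _).mul (measurable_deriv _)).aestronglyMeasurable ?_
    refine Filter.Eventually.of_forall fun y => ?_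
    rw [norm_mul]
    exact mul_le_mul (norm_deriv_le_of_lipschitz hC) (norm_deriv_le_of_lipschitz hC')
      (norm_nonneg _) C.2
  have hfac : ∀ s r, Integrable (gfac d g g' s r) μ := by
    intro s r
    by_cases h : r = s
    · have : gfac d g g' s r = fun y => deriv (g r) y * deriv (g' r) y := by
        funext y; simp [gfac, h]
      rw [this]; exact hstiff r
    · have : gfac d g g' s r = fun y => g r y * g' r y := by
        funext y; simp [gfac, h]
      rw [this]; exact hmass r
  have hI1 : ∀ s, Integrable (fun x : Fin d → ℝ => α s * ∏ r, gfac d g g' s r (x r))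
      (Measure.pi fun _ : Fin d => μ) := fun s =>
    (Integrable.fintype_prod (μ := fun _ : Fin d => μ) (hfac s)).const_mul _
  have hI2 : Integrable (fun x : Fin d → ℝ => κ * ∏ r, (g r (x r) * g' r (x r)))
      (Measure.pi fun _ : Fin d => μ) :=
    (Integrable.fintype_prod (μ := fun _ : Fin d => μ) hmass).const_mul _
  rw [integral_add (integrable_finsetSum _ fun s _ => hI1 s) hI2,
    integral_finsetSum _ fun s _ => hI1 s, integral_const_mul,
    integral_fintype_prod_eq_prod (μ := fun _ : Fin d => μ) (fun r y => g r y * g' r y),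
    Finset.prod_eq_zero (Finset.mem_univ s₁) h₁, mul_zero, add_zero]
  apply Finset.sum_eq_zero
  intro s _
  rw [integral_const_mul, integral_fintype_prod_eq_prod (μ := fun _ : Fin d => μ) (gfac d g g' s)]
  have key : ∀ r, r ≠ s → ∫ y, g r y * g' r y ∂μ = 0 → α s * ∏ r, ∫ y, gfac d g g' s r y ∂μ = 0 := by
    intro r hr h
    rw [Finset.prod_eq_zero (Finset.mem_univ r), mul_zero]
    rw [← h]
    congr 1
    funext y
    simp [gfac, hr]
  by_cases h : s₁ = s
  · exact key s₂ (fun h' => hs (h.trans h'.symm)) h₂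
  · exact key s₁ h h₁

/-- piecewise affine on dyadic mesh `2^-s`, Lipschitz, vanishing at `0` and `1` -/
def Good (s : ℕ) (f : ℝ → ℝ) : Prop :=
  (∀ k : ℕ, ∃ c e : ℝ, ∀ x : ℝ, (k:ℝ) ≤ x * 2 ^ s → x * 2 ^ s ≤ k + 1 → f x = c * x + e) ∧
  (∃ K : ℝ, ∀ x y, |f x - f y| ≤ K * |x - y|) ∧ f 0 = 0 ∧ f 1 = 0

theorem Good.lin {s : ℕ} {f g : ℝ → ℝ} (hf : Good s f) (hg : Good s g) (a b : ℝ) :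
    Good s (fun x => a * f x + b * g x) := by
  obtain ⟨hf1, ⟨K, hK⟩, hf3, hf4⟩ := hf
  obtain ⟨hg1, ⟨L, hL⟩, hg3, hg4⟩ := hg
  refine ⟨fun k => ?_, ⟨|a| * K + |b| * L, fun x y => ?_⟩, by simp [hf3, hg3], by simp [hf4, hg4]⟩
  · obtain ⟨c, e, h⟩ := hf1 k
    obtain ⟨c', e', h'⟩ := hg1 k
    refine ⟨a * c + b * c', a * e + b * e', fun x h1 h2 => ?_⟩
    simp only [h x h1 h2, h' x h1 h2]; ring
  · have : a * f x + b * g x - (a * f y + b * g y) = a * (f x - f y) + b * (g x - g y) := by ring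
    simp only [this]
    refine (abs_add_le _ _).trans ?_
    rw [abs_mul, abs_mul]
    have h1 := mul_le_mul_of_nonneg_left (hK x y) (abs_nonneg a)
    have h2 := mul_le_mul_of_nonneg_left (hL x y) (abs_nonneg b)
    nlinarith

theorem Good.succ {s : ℕ} {f : ℝ → ℝ} (hf : Good s f) : Good (s + 1) f := by
  obtain ⟨hf1, h⟩ := hf
  refine ⟨fun k => ?_, h⟩
  obtain ⟨c, e, h⟩ := hf1 (k / 2)
  refine ⟨c, e, fun x h1 h2 => h x ?_ ?_⟩
  · rw [pow_succ] at h1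
    have : ((2 * (k / 2) : ℕ) : ℝ) ≤ k := by exact_mod_cast Nat.mul_div_le k 2
    push_cast at this
    linarith
  · rw [pow_succ] at h2
    have : (k : ℝ) + 1 ≤ ((2 * (k / 2) + 2 : ℕ) : ℝ) := by
      have : k + 1 ≤ 2 * (k / 2) + 2 := by omega
      exact_mod_cast this
    push_cast at this
    linarith

theorem Good.mono {s s' : ℕ} (h : s ≤ s') {f : ℝ → ℝ} (hf : Good s f) : Good s' f := by
  induction h with
  | refl => exact hf
  | step _ ih => exact ih.succ

theorem hat_good (t j : ℕ) (h1 : 1 ≤ j) (h2 : j + 1 ≤ 2 ^ (t + 1)) : Good (t + 1) (hat t j) := by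
  have h1' : (1:ℝ) ≤ j := by exact_mod_cast h1
  have h2' : (j:ℝ) + 1 ≤ 2 ^ (t + 1) := by exact_mod_cast h2
  refine ⟨fun k => ?_, ⟨2 ^ (t + 1), fun x y => ?_⟩, ?_, ?_⟩
  · rcases lt_trichotomy (k + 1) j with h | h | h
    · refine ⟨0, 0, fun x ha hb => ?_⟩
      have : (k : ℝ) + 1 + 1 ≤ j := by exact_mod_cast h
      unfold hat
      rw [abs_of_nonpos (by linarith), max_eq_left (by linarith)]; ring
    · refine ⟨2 ^ (t + 1), 1 - j, fun x ha hb => ?_⟩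
      have : (k : ℝ) + 1 = j := by exact_mod_cast h
      unfold hat
      rw [abs_of_nonpos (by linarith), max_eq_right (by linarith)]; ring
    · rcases Nat.lt_or_ge j k with h' | h'
      · refine ⟨0, 0, fun x ha hb => ?_⟩
        have : (j : ℝ) + 1 ≤ k := by exact_mod_cast h'
        unfold hat
        rw [abs_of_nonneg (by linarith), max_eq_left (by linarith)]; ring
      · refine ⟨- 2 ^ (t + 1), 1 + j, fun x ha hb => ?_⟩
        have : (k : ℝ) = j := by exact_mod_cast (by omega : k = j)
        unfold hat
        rw [abs_of_nonneg (by linarith), max_eq_right (by linarith)]; ring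
  · unfold hat
    refine (abs_max_sub_max_le_max _ _ _ _).trans ?_
    refine max_le (by rw [sub_self, abs_zero]; positivity) ?_
    have : 1 - |x * 2 ^ (t + 1) - (j:ℝ)| - (1 - |y * 2 ^ (t + 1) - (j:ℝ)|)
      = |y * 2 ^ (t + 1) - (j:ℝ)| - |x * 2 ^ (t + 1) - (j:ℝ)| := by ring
    rw [this]
    refine (abs_abs_sub_abs_le_abs_sub _ _).trans ?_
    have : y * 2 ^ (t + 1) - (j:ℝ) - (x * 2 ^ (t + 1) - (j:ℝ)) = 2 ^ (t+1) * (y - x) := by ring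
    rw [this, abs_mul, abs_of_nonneg (by positivity), abs_sub_comm]
  · unfold hat
    rw [abs_of_nonpos (by linarith), max_eq_left (by linarith)]
  · unfold hat
    rw [abs_of_nonneg (by linarith), max_eq_left (by linarith)]

/-- `prew` at positive level is one of three combinations of interior hats -/
theorem prew_cases (t i : ℕ) (ht : t ≠ 0) (hi : i ∈ Xi t) :
    (i = 1 ∧ ∀ x, prew t i x = 9/10 * hat t 1 x + (-3/5) * hat t 2 x + 1/10 * hat t 3 x) ∨
    (∃ j, Even j ∧ j + 4 = 2 ^ (t + 1) ∧ ∀ x, prew t i x =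
      9/10 * hat t (j+3) x + (-3/5) * hat t (j+2) x + 1/10 * hat t (j+1) x) ∨
    (∃ j, Even j ∧ j + 6 ≤ 2 ^ (t + 1) ∧ ∀ x, prew t i x =
      hat t (j+3) x + (-3/5) * (hat t (j+4) x + hat t (j+2) x)
        + 1/10 * (hat t (j+5) x + hat t (j+1) x)) := by
  unfold Xi Idx at hi
  rw [if_neg ht] at hi
  simp only [Finset.mem_filter, Finset.mem_Icc] at hi
  obtain ⟨⟨ha, hb⟩, k, hk⟩ := hi
  obtain ⟨u, rfl⟩ : ∃ u, t = u + 1 := ⟨t - 1, by omega⟩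
  have hp : 2 ^ (u + 1 + 1) = 4 * 2 ^ u := by ring
  have hu : 1 ≤ 2 ^ u := Nat.one_le_two_pow
  by_cases h1 : i = 1
  · left
    refine ⟨h1, fun x => ?_⟩
    unfold prew
    rw [if_neg ht, if_pos h1]; ring
  · right
    by_cases h2 : i = 2 ^ (u + 1 + 1) - 1
    · left
      refine ⟨i - 3, ⟨k - 1, by omega⟩, by omega, fun x => ?_⟩
      unfold prew
      rw [if_neg ht, if_neg h1, if_pos h2, show i - 3 + 3 = i by omega,
        show i - 3 + 2 = i - 1 by omega, show i - 3 + 1 = i - 2 by omega]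
      ring
    · right
      refine ⟨i - 3, ⟨k - 1, by omega⟩, by omega, fun x => ?_⟩
      unfold prew
      rw [if_neg ht, if_neg h1, if_neg h2, show i - 3 + 3 = i by omega,
        show i - 3 + 2 = i - 1 by omega, show i - 3 + 1 = i - 2 by omega,
        show i - 3 + 4 = i + 1 by omega, show i - 3 + 5 = i + 2 by omega]
      ring

theorem prew_good (t i : ℕ) (hi : i ∈ Xi t) : Good (t + 1) (prew t i) := by
  by_cases ht : t = 0
  · subst ht
    have : prew 0 i = hat 0 1 := by funext x; simp [prew]
    rw [this]
    exact hat_good 0 1 le_rfl (by norm_num)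
  · have hp : 4 ≤ 2 ^ (t + 1) := by
      calc 4 = 2 ^ 2 := rfl
        _ ≤ 2 ^ (t + 1) := Nat.pow_le_pow_right (by norm_num) (by omega)
    rcases prew_cases t i ht hi with ⟨_, h⟩ | ⟨j, _, hj, h⟩ | ⟨j, _, hj, h⟩
    · have H := (((hat_good t 1 (by omega) (by omega)).lin
        (hat_good t 2 (by omega) (by omega)) (9/10) (-3/5)).lin
        (hat_good t 3 (by omega) (by omega)) 1 (1/10))
      convert H using 1
      funext x; rw [h]; ring
    · have H := (((hat_good t (j+3) (by omega) (by omega)).lin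
        (hat_good t (j+2) (by omega) (by omega)) (9/10) (-3/5)).lin
        (hat_good t (j+1) (by omega) (by omega)) 1 (1/10))
      convert H using 1
      funext x; rw [h]; ring
    · have H := ((((hat_good t (j+3) (by omega) (by omega)).lin
        (hat_good t (j+4) (by omega) (by omega)) 1 (-3/5)).lin
        (hat_good t (j+2) (by omega) (by omega)) 1 (-3/5)).lin
        ((hat_good t (j+5) (by omega) (by omega)).lin
        (hat_good t (j+1) (by omega) (by omega)) 1 1) 1 (1/10))
      convert H using 1
      funext x; rw [h]; ring

theorem Good.cont {s : ℕ} {f : ℝ → ℝ} (hf : Good s f) : Continuous f := by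
  obtain ⟨C, hC⟩ := lip_facts hf.2.1
  exact hC.continuous

theorem cubic_int (p q c e a b : ℝ) :
    ∫ x in a..b, (p * x + q) * (c * x + e) =
      (p * c / 3 * b ^ 3 + (p * e + q * c) / 2 * b ^ 2 + q * e * b)
      - (p * c / 3 * a ^ 3 + (p * e + q * c) / 2 * a ^ 2 + q * e * a) := by
  refine intervalIntegral.integral_eq_sub_of_hasDerivAt
    (f := fun x => p * c / 3 * x ^ 3 + (p * e + q * c) / 2 * x ^ 2 + q * e * x) ?_ ?_
  · intro x _
    have h := (((hasDerivAt_pow 3 x).const_mul (p * c / 3)).add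
      ((hasDerivAt_pow 2 x).const_mul ((p * e + q * c) / 2))).add
      ((hasDerivAt_id x).const_mul (q * e))
    refine h.congr_deriv ?_
    norm_num
    ring
  · exact Continuous.intervalIntegrable (by fun_prop) _ _

/-- Mass of a good function against an interior hat. -/
theorem hat_mass (t k : ℕ) (hk : k + 2 ≤ 2 ^ (t + 1)) (f : ℝ → ℝ) (hf : Good (t + 1) f) :
    ∫ x in Set.Icc (0:ℝ) 1, f x * hat t (k + 1) x =
      (f (k / 2 ^ (t + 1)) + 4 * f ((k + 1) / 2 ^ (t + 1)) + f ((k + 2) / 2 ^ (t + 1)))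
        / (6 * 2 ^ (t + 1)) := by
  have hfc := hf.cont
  have hgc : Continuous (hat t (k + 1)) := (hat_good t (k + 1) (by omega) (by omega)).cont
  have hk' : (k:ℝ) + 2 ≤ 2 ^ (t + 1) := by exact_mod_cast hk
  have hk0 : (0:ℝ) ≤ k := k.cast_nonneg
  rw [integral_Icc_eq_integral_Ioc, ← intervalIntegral.integral_of_le zero_le_one]
  have hN : (0:ℝ) < 2 ^ (t + 1) := by positivity
  obtain ⟨c, e, h1⟩ := hf.1 k
  obtain ⟨c', e', h2⟩ := hf.1 (k + 1)
  push_cast at h2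
  have hhat : ∀ x, hat t (k + 1) x = max 0 (1 - |x * 2 ^ (t + 1) - (k + 1 : ℝ)|) := by
    intro x; simp [hat]
  generalize (2:ℝ) ^ (t + 1) = N at *
  have hint : ∀ a b : ℝ, IntervalIntegrable (fun x => f x * hat t (k + 1) x) volume a b :=
    fun a b => (hfc.mul hgc).intervalIntegrable a b
  rw [← intervalIntegral.integral_add_adjacent_intervals (hint 0 (k / N)) (hint (k / N) 1),
    ← intervalIntegral.integral_add_adjacent_intervals (hint (k / N) ((k + 1) / N))
      (hint ((k + 1) / N) 1),
    ← intervalIntegral.integral_add_adjacent_intervals (hint ((k + 1) / N) ((k + 2) / N))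
      (hint ((k + 2) / N) 1)]
  have i1 : ∫ x in (0:ℝ)..(k / N), f x * hat t (k + 1) x = 0 := by
    rw [intervalIntegral.integral_congr (g := fun _ => 0)]
    · simp
    · intro x hx
      rw [Set.uIcc_of_le (by positivity)] at hx
      have := (le_div_iff₀ hN).1 hx.2
      simp only [hhat]
      rw [abs_of_nonpos (by linarith), max_eq_left (by linarith), mul_zero]
  have i4 : ∫ x in ((k + 2) / N)..1, f x * hat t (k + 1) x = 0 := by
    rw [intervalIntegral.integral_congr (g := fun _ => 0)]
    · simp
    · intro x hx
      rw [Set.uIcc_of_le (by rw [div_le_one hN]; exact hk')] at hx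
      have := (div_le_iff₀ hN).1 hx.1
      simp only [hhat]
      rw [abs_of_nonneg (by linarith), max_eq_left (by linarith), mul_zero]
  have i2 : ∫ x in (k / N)..((k + 1) / N), f x * hat t (k + 1) x
      = ∫ x in (k / N)..((k + 1) / N), (c * x + e) * (N * x + -k) := by
    apply intervalIntegral.integral_congr
    intro x hx
    rw [Set.uIcc_of_le (by gcongr; linarith)] at hx
    have ha := (div_le_iff₀ hN).1 hx.1
    have hb := (le_div_iff₀ hN).1 hx.2
    simp only [hhat]
    rw [abs_of_nonpos (by linarith), max_eq_right (by linarith), h1 x ha hb]; ring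
  have i3 : ∫ x in ((k + 1) / N)..((k + 2) / N), f x * hat t (k + 1) x
      = ∫ x in ((k + 1) / N)..((k + 2) / N), (c' * x + e') * (-N * x + (k + 2)) := by
    apply intervalIntegral.integral_congr
    intro x hx
    rw [Set.uIcc_of_le (by gcongr; linarith)] at hx
    have ha := (div_le_iff₀ hN).1 hx.1
    have hb := (le_div_iff₀ hN).1 hx.2
    simp only [hhat]
    rw [abs_of_nonneg (by linarith), max_eq_right (by linarith), h2 x ha (by linarith)]; ring
  have e0 : (k:ℝ) / N * N = k := by field_simp
  have e1 : ((k:ℝ) + 1) / N * N = k + 1 := by field_simp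
  have e2 : ((k:ℝ) + 2) / N * N = k + 2 := by field_simp
  have f0 := h1 (k / N) (by linarith) (by linarith)
  have f1 := h1 ((k + 1) / N) (by linarith) (by linarith)
  have f1' := h2 ((k + 1) / N) (by linarith) (by linarith)
  have f2 := h2 ((k + 2) / N) (by linarith) (by linarith)
  rw [i1, i2, i3, i4, cubic_int, cubic_int]
  have : 4 * f ((k + 1) / N) = 2 * (c * ((k + 1) / N) + e) + 2 * (c' * ((k + 1) / N) + e') := by
    linarith
  rw [this, f0, f2]
  field_simp
  ring

/-- midpoint rule on a coarse cell -/
theorem Good.mid {t : ℕ} {f : ℝ → ℝ} (hf : Good t f) (j : ℕ) (hj : Even j) :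
    f ((j + 1) / 2 ^ (t + 1)) = (f (j / 2 ^ (t + 1)) + f ((j + 2) / 2 ^ (t + 1))) / 2 := by
  obtain ⟨m, rfl⟩ := hj
  obtain ⟨c, e, h⟩ := hf.1 m
  have hN : (0:ℝ) < 2 ^ t := by positivity
  rw [pow_succ]
  push_cast
  generalize (2:ℝ) ^ t = N at *
  have e0 : ((m:ℝ) + m) / (N * 2) * N = m := by field_simp; ring
  have e1 : ((m:ℝ) + m + 1) / (N * 2) * N = m + 1 / 2 := by field_simp; ring
  have e2 : ((m:ℝ) + m + 2) / (N * 2) * N = m + 1 := by field_simp; ring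
  rw [h _ (by linarith) (by linarith), h _ (by linarith) (by linarith),
    h _ (by linarith) (by linarith)]
  field_simp
  ring

theorem ortho (t i : ℕ) (ht : t ≠ 0) (hi : i ∈ Xi t) (f : ℝ → ℝ) (hf : Good t f) :
    ∫ x in Set.Icc (0:ℝ) 1, f x * prew t i x = 0 := by
  have hp : 4 ≤ 2 ^ (t + 1) := by
    calc 4 = 2 ^ 2 := rfl
      _ ≤ 2 ^ (t + 1) := Nat.pow_le_pow_right (by norm_num) (by omega)
  have hm := hat_mass t (f := f) (hf := hf.succ)
  have hI : ∀ k, 1 ≤ k → k + 1 ≤ 2 ^ (t + 1) →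
      Integrable (fun x => f x * hat t k x) (volume.restrict (Set.Icc (0:ℝ) 1)) := fun k h1 h2 =>
    (hf.cont.mul (hat_good t k h1 h2).cont).continuousOn.integrableOn_compact isCompact_Icc
  have three : ∀ k₁ k₂ k₃ : ℕ, (1 ≤ k₁ ∧ k₁ + 1 ≤ 2 ^ (t + 1)) → (1 ≤ k₂ ∧ k₂ + 1 ≤ 2 ^ (t + 1)) →
      (1 ≤ k₃ ∧ k₃ + 1 ≤ 2 ^ (t + 1)) → ∀ a b c : ℝ,
      Integrable (fun x => f x * (a * hat t k₁ x + b * hat t k₂ x + c * hat t k₃ x))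
        (volume.restrict (Set.Icc (0:ℝ) 1)) ∧
      ∫ x in Set.Icc (0:ℝ) 1, f x * (a * hat t k₁ x + b * hat t k₂ x + c * hat t k₃ x)
      = a * (∫ x in Set.Icc (0:ℝ) 1, f x * hat t k₁ x)
        + b * (∫ x in Set.Icc (0:ℝ) 1, f x * hat t k₂ x)
        + c * (∫ x in Set.Icc (0:ℝ) 1, f x * hat t k₃ x) := by
    intro k₁ k₂ k₃ h₁ h₂ h₃ a b c
    have i1 := (hI k₁ h₁.1 h₁.2).const_mul a
    have i2 := (hI k₂ h₂.1 h₂.2).const_mul b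
    have i3 := (hI k₃ h₃.1 h₃.2).const_mul c
    have hfun : (fun x => f x * (a * hat t k₁ x + b * hat t k₂ x + c * hat t k₃ x))
      = fun x => a * (f x * hat t k₁ x) + b * (f x * hat t k₂ x) + c * (f x * hat t k₃ x) := by
      funext x; ring
    rw [hfun]
    refine ⟨(i1.add i2).add i3, ?_⟩
    have i12 : Integrable (fun x => a * (f x * hat t k₁ x) + b * (f x * hat t k₂ x))
        (volume.restrict (Set.Icc (0:ℝ) 1)) := i1.add i2
    rw [integral_add i12 i3, integral_add i1 i2, integral_const_mul, integral_const_mul,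
      integral_const_mul]
  have hN : (0:ℝ) < 2 ^ (t + 1) := by positivity
  rcases prew_cases t i ht hi with ⟨_, h⟩ | ⟨j, hje, hj, h⟩ | ⟨j, hje, hj, h⟩
  · simp only [h]
    rw [(three 1 2 3 (by omega) (by omega) (by omega) _ _ _).2,
      hm 0 (by omega), hm 1 (by omega), hm 2 (by omega)]
    have m0 := hf.mid 0 (by decide)
    have m2 := hf.mid 2 (by decide)
    have z := hf.2.2.1
    norm_num at *
    rw [z] at m0 ⊢
    rw [m0, m2]
    field_simp
    ring
  · simp only [h]
    rw [(three (j+3) (j+2) (j+1) (by omega) (by omega) (by omega) _ _ _).2,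
      hm j (by omega), hm (j+1) (by omega), hm (j+2) (by omega)]
    have m0 := hf.mid j hje
    have m2 := hf.mid (j+2) (hje.add (by decide))
    have z : f ((j + 4) / 2 ^ (t + 1)) = 0 := by
      have : (j:ℝ) + 4 = 2 ^ (t + 1) := by exact_mod_cast hj
      rw [this, div_self hN.ne']; exact hf.2.2.2
    push_cast at *
    simp only [add_assoc] at *
    norm_num at *
    rw [z] at m2 ⊢
    rw [m0, m2]
    field_simp
    ring
  · have hsplit : ∀ x, f x * prew t i x =
        f x * (1 * hat t (j+3) x + (-3/5) * hat t (j+4) x + (-3/5) * hat t (j+2) x)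
        + f x * (1/10 * hat t (j+5) x + 1/10 * hat t (j+1) x + 0 * hat t (j+1) x) := by
      intro x; rw [h]; ring
    simp only [hsplit]
    have T1 := three (j+3) (j+4) (j+2) (by omega) (by omega) (by omega) 1 (-3/5) (-3/5)
    have T2 := three (j+5) (j+1) (j+1) (by omega) (by omega) (by omega) (1/10) (1/10) 0
    rw [integral_add T1.1 T2.1, T1.2, T2.2,
      hm j (by omega), hm (j+1) (by omega), hm (j+2) (by omega), hm (j+3) (by omega),
      hm (j+4) (by omega)]
    have m0 := hf.mid j hje
    have m2 := hf.mid (j+2) (hje.add (by decide))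
    have m4 := hf.mid (j+4) (hje.add (by decide))
    push_cast at *
    simp only [add_assoc] at *
    norm_num at *
    rw [m0, m2, m4]
    field_simp
    ring

theorem prew_ortho (t t' i i' : ℕ) (h : t < t') (hi : i ∈ Xi t) (hi' : i' ∈ Xi t') :
    ∫ x in Set.Icc (0:ℝ) 1, prew t i x * prew t' i' x = 0 :=
  ortho t' i' (by omega) hi' _ ((prew_good t i hi).mono h)

/-- For constant `κ ≥ 0` and constant diagonal positive definite `A = diag(α)`,
the semi-orthogonal bilinear form `a_n^{semi-ortho}` agrees with the exact
bilinear form `a` on all pairs of sparse grid pre-wavelet basis functions;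
i.e. the two stiffness matrices are equal entrywise. -/
theorem semi_ortho_stiffness_exact (d n : ℕ) (κ : ℝ) (hκ : 0 ≤ κ)
    (α : Fin d → ℝ) (hα : ∀ s, 0 < α s)
    (t t' i i' : Fin d → ℕ)
    (hi : ∀ s, i s ∈ Xi (t s)) (hi' : ∀ s, i' s ∈ Xi (t' s))
    (htn : (∑ s, t s) ≤ n) (ht'n : (∑ s, t' s) ≤ n) :
    (if (∑ s, max (t s) (t' s)) ≤ n
      then bform d α κ (tprew d t i) (tprew d t' i')
      else 0)
    = bform d α κ (tprew d t i) (tprew d t' i') := by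
  split_ifs with hmax
  · rfl
  · symm
    have hs₁ : ∃ s, t s < t' s := by
      by_contra hcon
      push Not at hcon
      apply hmax
      rw [Finset.sum_congr rfl fun s _ => max_eq_left (hcon s)]
      exact htn
    have hs₂ : ∃ s, t' s < t s := by
      by_contra hcon
      push Not at hcon
      apply hmax
      rw [Finset.sum_congr rfl fun s _ => max_eq_right (hcon s)]
      exact ht'n
    obtain ⟨s₁, h₁⟩ := hs₁
    obtain ⟨s₂, h₂⟩ := hs₂
    refine bform_zero d α κ (fun r => prew (t r) (i r)) (fun r => prew (t' r) (i' r))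
      (fun r => lip_facts (prew_good _ _ (hi r)).2.1)
      (fun r => lip_facts (prew_good _ _ (hi' r)).2.1) s₁ s₂ ?_
      (prew_ortho _ _ _ _ h₁ (hi s₁) (hi' s₁)) ?_
    · rintro rfl
      omega
    · have := prew_ortho _ _ _ _ h₂ (hi' s₂) (hi s₂)
      simpa only [mul_comm] using this
end
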